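/- Let J ≥ 1 and let π_1, π_2 be polygonal curves in ℝ² with d_dF(π_1, π_2) ≤ 1. Then d_dF( U_L(2J) ∘ π_1 ∘ U_R(2J), U(2J−1) ∘ π_2 ∘ U(2J+1) ) ≤ 1. -/

import Mathlib

noncomputable section
open Real

/-- A point of the Euclidean plane. -/
def pt (x y : ℝ) : EuclideanSpace ℝ (Fin 2) := (WithLp.equiv 2 (Fin 2 → ℝ)).symm ![x, y]
/-- A single step of a discrete traversal: advance the index in the first curve,
in the second curve, or in both, each by exactly one. -/
def IsStep (a b : ℕ × ℕ) : Prop :=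
  (b.1 = a.1 + 1 ∧ b.2 = a.2) ∨ (b.1 = a.1 ∧ b.2 = a.2 + 1) ∨ (b.1 = a.1 + 1 ∧ b.2 = a.2 + 1)

/-- A discrete traversal of a pair of polygonal curves with `n` and `m` vertices
(indices are 0-based): it starts at `(0,0)`, ends at `(n-1,m-1)`, and each step
advances one index or both. -/
def IsTraversal (n m : ℕ) (T : List (ℕ × ℕ)) : Prop :=
  T.head? = some (0, 0) ∧ T.getLast? = some (n - 1, m - 1) ∧ T.Chain' IsStep ∧
    ∀ p ∈ T, p.1 < n ∧ p.2 < m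

/-- The discrete Fréchet distance of two polygonal curves, given by their
(nonempty) lists of vertices: the least `D` such that some discrete traversal
has width at most `D`. -/
def dDF {d : ℕ} (P Q : List (EuclideanSpace ℝ (Fin d))) : ℝ :=
  sInf { D | ∃ T : List (ℕ × ℕ), IsTraversal P.length Q.length T ∧
    ∀ p ∈ T, dist (P.getD p.1 0) (Q.getD p.2 0) ≤ D }
/-- `ρ = 1/√2`. -/
def rho : ℝ := 1 / Real.sqrt 2

/-- The curve `U_L(j)`. -/
def UL (j : ℕ) : List (EuclideanSpace ℝ (Fin 2)) :=
  [pt ((j : ℝ) * rho) 0, pt (((j : ℝ) - 1) * rho) rho, pt (((j : ℝ) - 1) * rho) (3 * rho),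
   pt (((j : ℝ) - 1) * rho) (2 * rho), pt (((j : ℝ) - 1) * rho) rho]

/-- The curve `U_R(j)`. -/
def UR (j : ℕ) : List (EuclideanSpace ℝ (Fin 2)) :=
  [pt (((j : ℝ) + 1) * rho) rho, pt (((j : ℝ) + 1) * rho) (2 * rho),
   pt (((j : ℝ) + 1) * rho) (3 * rho), pt (((j : ℝ) + 1) * rho) rho, pt ((j : ℝ) * rho) 0]

/-- The curve `U(j) = U_L(j) ∘ U_R(j)`. -/
def Ucurve (j : ℕ) : List (EuclideanSpace ℝ (Fin 2)) := UL j ++ UR j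

/-- Translation of a polygonal curve by `z` in the `x`-direction. -/
def trX (z : ℝ) (P : List (EuclideanSpace ℝ (Fin 2))) : List (EuclideanSpace ℝ (Fin 2)) :=
  P.map fun p => p + pt z 0

/-- Some discrete traversal of `P` and `Q` has width at most `D`. -/
def HasTraversal {d : ℕ} (P Q : List (EuclideanSpace ℝ (Fin d))) (D : ℝ) : Prop :=
  ∃ T : List (ℕ × ℕ), IsTraversal P.length Q.length T ∧
    ∀ p ∈ T, dist (P.getD p.1 0) (Q.getD p.2 0) ≤ D

theorem IsTraversal.snoc {n m n' m' : ℕ} {T : List (ℕ × ℕ)} (h : IsTraversal n m T)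
    (hn : n ≤ n') (hm : m ≤ m') (hn' : 0 < n') (hm' : 0 < m')
    (hs : IsStep (n - 1, m - 1) (n' - 1, m' - 1)) :
    IsTraversal n' m' (T ++ [(n' - 1, m' - 1)]) := by
  obtain ⟨h1, h2, h3, h4⟩ := h
  refine ⟨by simp [List.head?_append, h1], by simp, ?_, ?_⟩
  · refine List.isChain_append.2 ⟨h3, by simp, ?_⟩
    intro x hx y hy
    rw [h2] at hx
    simp only [Option.mem_def, Option.some.injEq, List.head?_cons] at hx hy
    subst hx hy
    exact hs
  · intro p hp
    rcases List.mem_append.1 hp with hp | hp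
    · have := h4 p hp
      omega
    · rw [List.mem_singleton] at hp
      subst hp
      dsimp only
      omega

theorem exists_isTraversal (n m : ℕ) : ∃ T, IsTraversal (n + 1) (m + 1) T := by
  induction m with
  | zero =>
    induction n with
    | zero => exact ⟨[(0, 0)], by simp, by simp, List.isChain_singleton _, by simp⟩
    | succ n ih =>
      obtain ⟨T, hT⟩ := ih
      exact ⟨_, hT.snoc (by omega) le_rfl (by omega) (by omega) (by simp [IsStep])⟩
  | succ m ih =>
    obtain ⟨T, hT⟩ := ih
    exact ⟨_, hT.snoc le_rfl (by omega) (by omega) (by omega) (by simp [IsStep])⟩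

theorem exists_hasTraversal {d : ℕ} {P Q : List (EuclideanSpace ℝ (Fin d))}
    (hP : P ≠ []) (hQ : Q ≠ []) : ∃ D, HasTraversal P Q D := by
  obtain ⟨T, hT⟩ := exists_isTraversal (P.length - 1) (Q.length - 1)
  have hP' := List.length_pos_of_ne_nil hP
  have hQ' := List.length_pos_of_ne_nil hQ
  rw [Nat.sub_add_cancel hP', Nat.sub_add_cancel hQ'] at hT
  obtain ⟨D, hD⟩ := (T.toFinset.image
    fun p : ℕ × ℕ => dist (P.getD p.1 0) (Q.getD p.2 0)).bddAbove
  refine ⟨D, T, hT, fun p hp => hD ?_⟩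
  simp only [Finset.coe_image, Set.mem_image, Finset.mem_coe, List.mem_toFinset]
  exact ⟨p, hp, rfl⟩

theorem HasTraversal.mono {d : ℕ} {P Q : List (EuclideanSpace ℝ (Fin d))} {D D' : ℝ}
    (h : HasTraversal P Q D) (hD : D ≤ D') : HasTraversal P Q D' := by
  obtain ⟨T, hT, hw⟩ := h
  exact ⟨T, hT, fun p hp => (hw p hp).trans hD⟩

theorem HasTraversal.nonneg {d : ℕ} {P Q : List (EuclideanSpace ℝ (Fin d))} {D : ℝ}
    (h : HasTraversal P Q D) : 0 ≤ D := by
  obtain ⟨T, hT, hw⟩ := h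
  exact dist_nonneg.trans (hw _ (List.mem_of_mem_head? hT.1))

theorem HasTraversal.dDF_le {d : ℕ} {P Q : List (EuclideanSpace ℝ (Fin d))} {D : ℝ}
    (h : HasTraversal P Q D) : dDF P Q ≤ D :=
  csInf_le ⟨0, fun _ hx => HasTraversal.nonneg hx⟩ h

theorem hasTraversal_of_dDF_lt {d : ℕ} {P Q : List (EuclideanSpace ℝ (Fin d))} {D : ℝ}
    (hP : P ≠ []) (hQ : Q ≠ []) (h : dDF P Q < D) : HasTraversal P Q D := by
  obtain ⟨D', hD', hlt⟩ := exists_lt_of_csInf_lt (exists_hasTraversal hP hQ) h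
  exact HasTraversal.mono hD' hlt.le

/-- Traversals of consecutive pieces can be concatenated. -/
theorem HasTraversal.append {d : ℕ} {P Q P' Q' : List (EuclideanSpace ℝ (Fin d))} {D : ℝ}
    (h : HasTraversal P Q D) (h' : HasTraversal P' Q' D) :
    HasTraversal (P ++ P') (Q ++ Q') D := by
  obtain ⟨T, ⟨h1, h2, h3, h4⟩, hw⟩ := h
  obtain ⟨T', ⟨h1', h2', h3', h4'⟩, hw'⟩ := h'
  have hpos := h4 _ (List.mem_of_mem_head? h1)
  have hpos' := h4' _ (List.mem_of_mem_head? h1')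
  dsimp only at hpos hpos'
  refine ⟨T ++ T'.map fun p => (P.length + p.1, Q.length + p.2), ⟨?_, ?_, ?_, ?_⟩, ?_⟩
  · simp [List.head?_append, h1]
  · simp only [List.getLast?_append, List.getLast?_map, h2', Option.map_some, Option.some_or,
      List.length_append, Option.some.injEq, Prod.mk.injEq]
    omega
  · refine List.isChain_append.2 ⟨h3, ?_, ?_⟩
    · refine List.isChain_map _ |>.2 (h3'.imp fun a b hab => ?_)
      simp only [IsStep] at hab ⊢
      omega
    · intro x hx y hy
      simp only [h2, List.head?_map, h1', Option.map_some, Option.mem_def,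
        Option.some.injEq] at hx hy
      subst hx hy
      simp only [IsStep]
      omega
  · intro p hp
    simp only [List.length_append]
    rcases List.mem_append.1 hp with hp | hp
    · have := h4 p hp
      omega
    · obtain ⟨q, hq, rfl⟩ := List.mem_map.1 hp
      have := h4' q hq
      dsimp only
      omega
  · intro p hp
    rcases List.mem_append.1 hp with hp | hp
    · rw [List.getD_append _ _ _ _ (h4 p hp).1, List.getD_append _ _ _ _ (h4 p hp).2]
      exact hw p hp
    · obtain ⟨q, hq, rfl⟩ := List.mem_map.1 hp
      rw [List.getD_append_right _ _ _ _ (Nat.le_add_right _ _),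
        List.getD_append_right _ _ _ _ (Nat.le_add_right _ _),
        Nat.add_sub_cancel_left, Nat.add_sub_cancel_left]
      exact hw' q hq

theorem rho_sq : rho ^ 2 = 1 / 2 := by
  rw [rho, div_pow, Real.sq_sqrt (by norm_num)]
  norm_num

theorem dist_pt_le_one {x y x' y' : ℝ} (h : (x - x') ^ 2 + (y - y') ^ 2 ≤ 1) :
    dist (pt x y) (pt x' y') ≤ 1 := by
  rw [EuclideanSpace.dist_eq, Real.sqrt_le_one]
  simpa [pt, Fin.sum_univ_two, Real.dist_eq, sq_abs] using h

theorem hasTraversal_UL_Ucurve (j : ℕ) : HasTraversal (UL (j + 1)) (Ucurve j) 1 := by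
  refine ⟨[(0, 0), (1, 1), (2, 2), (3, 3), (3, 4), (3, 5), (3, 6), (3, 7), (3, 8), (4, 9)],
    ⟨by simp, by simp [UL, UR, Ucurve], (by simp [IsStep] : List.IsChain IsStep _),
      by simp [UL, UR, Ucurve]⟩, ?_⟩
  simp only [UL, UR, Ucurve, List.forall_mem_cons, List.cons_append, List.nil_append,
    List.getD_cons_zero, List.getD_cons_succ, List.not_mem_nil, IsEmpty.forall_iff,
    implies_true, and_true, Nat.cast_add, Nat.cast_one]
  refine ⟨?_, ?_, ?_, ?_, ?_, ?_, ?_, ?_, ?_, ?_⟩ <;>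
    exact dist_pt_le_one (by linarith [rho_sq])

theorem hasTraversal_UR_Ucurve (j : ℕ) : HasTraversal (UR j) (Ucurve (j + 1)) 1 := by
  refine ⟨[(0, 0), (0, 1), (1, 2), (1, 3), (1, 4), (1, 5), (1, 6), (2, 7), (3, 8), (4, 9)],
    ⟨by simp, by simp [UL, UR, Ucurve], (by simp [IsStep] : List.IsChain IsStep _),
      by simp [UL, UR, Ucurve]⟩, ?_⟩
  simp only [UL, UR, Ucurve, List.forall_mem_cons, List.cons_append, List.nil_append,
    List.getD_cons_zero, List.getD_cons_succ, List.not_mem_nil, IsEmpty.forall_iff,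
    implies_true, and_true, Nat.cast_add, Nat.cast_one]
  refine ⟨?_, ?_, ?_, ?_, ?_, ?_, ?_, ?_, ?_, ?_⟩ <;>
    exact dist_pt_le_one (by linarith [rho_sq])

/-- for `J ≥ 1` and polygonal curves `π_1, π_2` with
`d_dF(π_1, π_2) ≤ 1`, we have
`d_dF(U_L(2J) ∘ π_1 ∘ U_R(2J), U(2J−1) ∘ π_2 ∘ U(2J+1)) ≤ 1`. -/
theorem stmt11 (J : ℕ) (hJ : 1 ≤ J) (π1 π2 : List (EuclideanSpace ℝ (Fin 2)))
    (hne1 : π1 ≠ []) (hne2 : π2 ≠ []) (h : dDF π1 π2 ≤ 1) :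
    dDF (UL (2 * J) ++ π1 ++ UR (2 * J))
        (Ucurve (2 * J - 1) ++ π2 ++ Ucurve (2 * J + 1)) ≤ 1 := by
  refine le_of_forall_pos_le_add fun ε hε => ?_
  have hle : (1 : ℝ) ≤ 1 + ε := by linarith
  have hL := hasTraversal_UL_Ucurve (2 * J - 1)
  rw [Nat.sub_add_cancel (by omega)] at hL
  have hmid : HasTraversal π1 π2 (1 + ε) := hasTraversal_of_dDF_lt hne1 hne2 (by linarith)
  exact (((hL.mono hle).append hmid).append
    ((hasTraversal_UR_Ucurve (2 * J)).mono hle)).dDF_le
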